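/- Pointwise weighted bound for the primitive φ: for every λ ∈ [0,1) there exists a constant C > 0, depending only on λ, such that for every t ≥ 0, every admissible g, every n ∈ ℕ, every multi-index α with |α| = n, and every (x,y,z) ∈ ℝ² × [0,∞): θ_λ(z) ⟨r⟩ⁿ |∂^α_h φ(x,y,z)| ≤ C θ_{λ−1}(z) ⟨t⟩^{1/4} ‖θ ⟨r⟩ⁿ ∂^α_h g(x,y,·)‖_{L²_z}. -/

import Mathlib

open MeasureTheory Filter Set

noncomputable section

/-- `⟨t⟩ = 1 + t` -/
def angT (t : ℝ) : ℝ := 1 + t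

/-- `θ_λ(z) = exp (λ z² / (8⟨t⟩))`; `θ = θ₁`. -/
def thw (t lam z : ℝ) : ℝ := Real.exp (lam * z ^ 2 / (8 * angT t))

/-- `⟨r⟩ = √(x² + y² + 1)` -/
def angR (x y : ℝ) : ℝ := Real.sqrt (x ^ 2 + y ^ 2 + 1)

/-- `Mₙ = (n+1)⁴ / n!` -/
def Mfac (n : ℕ) : ℝ := ((n : ℝ) + 1) ^ 4 / (n.factorial : ℝ)

/-- `∂_x` -/
def pdx (f : ℝ → ℝ → ℝ → ℝ) : ℝ → ℝ → ℝ → ℝ := fun x y z => deriv (fun x' => f x' y z) x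
/-- `∂_y` -/
def pdy (f : ℝ → ℝ → ℝ → ℝ) : ℝ → ℝ → ℝ → ℝ := fun x y z => deriv (fun y' => f x y' z) y
/-- `∂_z` -/
def pdz (f : ℝ → ℝ → ℝ → ℝ) : ℝ → ℝ → ℝ → ℝ := fun x y z => deriv (fun z' => f x y z') z

/-- `∂^α_h = ∂_x^{α₁} ∂_y^{α₂}` for the multi-index `α = (a, b)` -/
def pdh (a b : ℕ) (f : ℝ → ℝ → ℝ → ℝ) : ℝ → ℝ → ℝ → ℝ := pdx^[a] (pdy^[b] f)

/-- `r ∂_r = x ∂_x + y ∂_y` -/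
def rdr (f : ℝ → ℝ → ℝ → ℝ) : ℝ → ℝ → ℝ → ℝ := fun x y z => x * pdx f x y z + y * pdy f x y z

/-- weighted `L²` norm over `ℝ² × (0,∞)` of `θ_λ ⟨r⟩ⁿ f` -/
def L2w (t lam : ℝ) (n : ℕ) (f : ℝ → ℝ → ℝ → ℝ) : ℝ :=
  Real.sqrt (∫ x : ℝ, ∫ y : ℝ, ∫ z in Ioi (0 : ℝ), (thw t lam z * angR x y ^ n * f x y z) ^ 2)

/-- weighted `L²_z` norm at fixed `(x, y)` of `θ_λ ⟨r⟩ⁿ f (x, y, ·)` -/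
def L2z (t lam : ℝ) (n : ℕ) (f : ℝ → ℝ → ℝ → ℝ) (x y : ℝ) : ℝ :=
  Real.sqrt (∫ z in Ioi (0 : ℝ), (thw t lam z * angR x y ^ n * f x y z) ^ 2)

/-- mixed `L^∞_h L²_z` norm of `θ_λ ⟨r⟩ⁿ f` -/
def LIh2z (t lam : ℝ) (n : ℕ) (f : ℝ → ℝ → ℝ → ℝ) : ℝ :=
  Real.sqrt (∫ z in Ioi (0 : ℝ), (⨆ p : ℝ × ℝ, |thw t lam z * angR p.1 p.2 ^ n * f p.1 p.2 z|) ^ 2)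

/-- mixed `L²_h L^∞_z` norm of `θ_λ ⟨r⟩ⁿ f` -/
def L2hIz (t lam : ℝ) (n : ℕ) (f : ℝ → ℝ → ℝ → ℝ) : ℝ :=
  Real.sqrt (∫ x : ℝ, ∫ y : ℝ,
    (⨆ z : Ioi (0 : ℝ), |thw t lam (z : ℝ) * angR x y ^ n * f x y (z : ℝ)|) ^ 2)

/-- the primitive `φ(x,y,z) = exp(−z²/(4⟨t⟩)) ∫₀^z g(x,y,s) exp(s²/(4⟨t⟩)) ds` -/
def phiF (t : ℝ) (g : ℝ → ℝ → ℝ → ℝ) : ℝ → ℝ → ℝ → ℝ := fun x y z =>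
  Real.exp (-(z ^ 2) / (4 * angT t)) * ∫ s in (0 : ℝ)..z, g x y s * Real.exp (s ^ 2 / (4 * angT t))

/-- `u^r = ∂_z φ` -/
def ur (t : ℝ) (g : ℝ → ℝ → ℝ → ℝ) : ℝ → ℝ → ℝ → ℝ := pdz (phiF t g)

/-- `u^z = −(x∂_x + y∂_y)φ − 2φ` -/
def uzv (t : ℝ) (g : ℝ → ℝ → ℝ → ℝ) : ℝ → ℝ → ℝ → ℝ := fun x y z =>
  -(rdr (phiF t g) x y z) - 2 * phiF t g x y z

/-- smoothness together with rapid decay in `z` of all derivatives -/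
def DecaySmooth (g : ℝ → ℝ → ℝ → ℝ) : Prop :=
  ContDiff ℝ (⊤ : ℕ∞) (fun p : ℝ × ℝ × ℝ => g p.1 p.2.1 p.2.2) ∧
  ∀ a b k m : ℕ, ∀ x y : ℝ,
    Tendsto (fun z : ℝ => z ^ m * pdz^[k] (pdh a b g) x y z) atTop (nhds 0)

/-- `θ ⟨r⟩^{|α|} ∂^α_h g ∈ L²(ℝ² × (0,∞))` for every `α` -/
def L2cond (t : ℝ) (g : ℝ → ℝ → ℝ → ℝ) : Prop :=
  ∀ a b : ℕ,
    Integrable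
      (fun p : ℝ × ℝ × ℝ =>
        (thw t 1 p.2.2 * angR p.1 p.2.1 ^ (a + b) * pdh a b g p.1 p.2.1 p.2.2) ^ 2)
      (volume.restrict {p : ℝ × ℝ × ℝ | 0 < p.2.2})

/-- `θ ⟨r⟩^{|α|} ∂^α_h ∂_z g ∈ L²(ℝ² × (0,∞))` for every `α` -/
def L2condZ (t : ℝ) (g : ℝ → ℝ → ℝ → ℝ) : Prop :=
  ∀ a b : ℕ,
    Integrable
      (fun p : ℝ × ℝ × ℝ =>
        (thw t 1 p.2.2 * angR p.1 p.2.1 ^ (a + b) * pdh a b (pdz g) p.1 p.2.1 p.2.2) ^ 2)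
      (volume.restrict {p : ℝ × ℝ × ℝ | 0 < p.2.2})

/-- `X_n(g, τ)` -/
def Xel (t τ : ℝ) (g : ℝ → ℝ → ℝ → ℝ) (n : ℕ) : ℝ :=
  (∑ a ∈ Finset.range (n + 1), L2w t 1 n (pdh a (n - a) g)) * τ ^ n * Mfac n

/-- `D_n(g, τ) = X_n(∂_z g, τ)` -/
def Del (t τ : ℝ) (g : ℝ → ℝ → ℝ → ℝ) (n : ℕ) : ℝ :=
  (∑ a ∈ Finset.range (n + 1), L2w t 1 n (pdh a (n - a) (pdz g))) * τ ^ n * Mfac n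

/-- `Y_n(g, τ)` (with `Y₀ = 0`) -/
def Yel (t τ : ℝ) (g : ℝ → ℝ → ℝ → ℝ) (n : ℕ) : ℝ :=
  (∑ a ∈ Finset.range (n + 1), L2w t 1 n (pdh a (n - a) g)) * τ ^ (n - 1) * (n : ℝ) * Mfac n

/-- `‖g‖_{X_τ}` -/
def Xnrm (t τ : ℝ) (g : ℝ → ℝ → ℝ → ℝ) : ℝ := ∑' n : ℕ, Xel t τ g n
/-- `‖g‖_{D_τ}` -/
def Dnrm (t τ : ℝ) (g : ℝ → ℝ → ℝ → ℝ) : ℝ := ∑' n : ℕ, Del t τ g n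
/-- `‖g‖_{Y_τ}` -/
def Ynrm (t τ : ℝ) (g : ℝ → ℝ → ℝ → ℝ) : ℝ := ∑' n : ℕ, Yel t τ g n

/-- triple integral over `ℝ² × (0,∞)` -/
def trip (F : ℝ → ℝ → ℝ → ℝ) : ℝ := ∫ x : ℝ, ∫ y : ℝ, ∫ z in Ioi (0 : ℝ), F x y z

/-- `I^α_1` -/
def I1 (t : ℝ) (g : ℝ → ℝ → ℝ → ℝ) (a b : ℕ) : ℝ :=
  -trip fun x y z =>
    thw t 2 z * angR x y ^ (2 * (a + b)) *
      pdh a b (fun x' y' z' => ur t g x' y' z' * rdr g x' y' z') x y z * pdh a b g x y z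

/-- `I^α_2` -/
def I2 (t : ℝ) (g : ℝ → ℝ → ℝ → ℝ) (a b : ℕ) : ℝ :=
  -trip fun x y z =>
    thw t 2 z * angR x y ^ (2 * (a + b)) *
      pdh a b (fun x' y' z' => uzv t g x' y' z' * pdz g x' y' z') x y z * pdh a b g x y z

/-- `I^α_3` -/
def I3 (t : ℝ) (g : ℝ → ℝ → ℝ → ℝ) (a b : ℕ) : ℝ :=
  -trip fun x y z =>
    thw t 2 z * angR x y ^ (2 * (a + b)) *
      pdh a b (fun x' y' z' => ur t g x' y' z' ^ 2) x y z * pdh a b g x y z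

/-- `I^α_4` -/
def I4 (t : ℝ) (g : ℝ → ℝ → ℝ → ℝ) (a b : ℕ) : ℝ :=
  (1 / (2 * angT t)) * trip fun x y z =>
    thw t 2 z * angR x y ^ (2 * (a + b)) *
      pdh a b
        (fun x' y' z' =>
          uzv t g x' y' z' * pdz (fun x'' y'' w => w * phiF t g x'' y'' w) x' y' z') x y z *
      pdh a b g x y z

/-- `I^α_5` -/
def I5 (t : ℝ) (g : ℝ → ℝ → ℝ → ℝ) (a b : ℕ) : ℝ :=
  -(1 / angT t) * trip fun x y z =>
    z * thw t 2 z * angR x y ^ (2 * (a + b)) *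
      pdh a b (fun x' y' z' => ur t g x' y' z' * phiF t g x' y' z') x y z * pdh a b g x y z

/-- `I^α_6` -/
def I6 (t : ℝ) (g : ℝ → ℝ → ℝ → ℝ) (a b : ℕ) : ℝ :=
  -(1 / (2 * angT t)) * trip fun x y z =>
    z * thw t 2 z * angR x y ^ (2 * (a + b)) *
      (∫ s in Ioi z, pdh a b (fun x' y' z' => ur t g x' y' z' ^ 2) x y s) * pdh a b g x y z

/-- `I^α_7` -/
def I7 (t : ℝ) (g : ℝ → ℝ → ℝ → ℝ) (a b : ℕ) : ℝ :=
  (1 / angT t) * trip fun x y z =>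
    z * thw t 2 z * angR x y ^ (2 * (a + b)) *
      (∫ s in Ioi z, pdh a b (fun x' y' z' => pdz (ur t g) x' y' z' * uzv t g x' y' z') x y s) *
      pdh a b g x y z

/-- `∑_{|α| = n} |I^α| τⁿ Mₙ / ‖θ ⟨r⟩ⁿ ∂^α_h g‖_{L²}` (with the convention `x / 0 = 0`) -/
def Qterm (t τ : ℝ) (g : ℝ → ℝ → ℝ → ℝ) (I : ℕ → ℕ → ℝ) (n : ℕ) : ℝ :=
  ∑ a ∈ Finset.range (n + 1), |I a (n - a)| * τ ^ n * Mfac n / L2w t 1 n (pdh a (n - a) g)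

/-- `∂_t` -/
def pdt (G : ℝ → ℝ → ℝ → ℝ → ℝ) (t x y z : ℝ) : ℝ := deriv (fun t' => G t' x y z) t

/-- the good-unknown axially symmetric Prandtl equation at the point `(t, x, y, z)` -/
def GoodEq (G : ℝ → ℝ → ℝ → ℝ → ℝ) (t x y z : ℝ) : Prop :=
  pdt G t x y z
      + ur t (G t) x y z * rdr (G t) x y z
      + uzv t (G t) x y z * pdz (G t) x y z
      - pdz (pdz (G t)) x y z
      + G t x y z / angT t
      + ur t (G t) x y z ^ 2
      - 1 / (2 * angT t) * (uzv t (G t) x y z * pdz (fun x' y' w => w * phiF t (G t) x' y' w) x y z)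
      + z / angT t * (ur t (G t) x y z * phiF t (G t) x y z)
      + z / (2 * angT t) * (∫ s in Ioi z, ur t (G t) x y s ^ 2)
      - z / angT t * (∫ s in Ioi z, pdz (ur t (G t)) x y s * uzv t (G t) x y s) = 0

open scoped ContDiff

lemma angT_pos {t : ℝ} (ht : 0 ≤ t) : 0 < angT t := by unfold angT; linarith

lemma one_le_angR (x y : ℝ) : 1 ≤ angR x y :=
  Real.one_le_sqrt.2 (by nlinarith [sq_nonneg x, sq_nonneg y])

lemma continuous_thw (t lam : ℝ) : Continuous (thw t lam) := by unfold thw; fun_prop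

/-- Joint smoothness in the three variables. -/
def SmoothThree (f : ℝ → ℝ → ℝ → ℝ) : Prop :=
  ContDiff ℝ ∞ (fun p : ℝ × ℝ × ℝ => f p.1 p.2.1 p.2.2)

namespace SmoothThree

variable {f : ℝ → ℝ → ℝ → ℝ}

lemma hasDerivAt_x (hf : SmoothThree f) (x y z : ℝ) :
    HasDerivAt (fun x' => f x' y z)
      (fderiv ℝ (fun p : ℝ × ℝ × ℝ => f p.1 p.2.1 p.2.2) (x, y, z) (1, 0, 0)) x :=
  HasFDerivAt.comp_hasDerivAt (l := fun p : ℝ × ℝ × ℝ => f p.1 p.2.1 p.2.2)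
    (f := fun x' => (x', y, z)) x
    ((ContDiff.differentiable hf (by simp)) (x, y, z)).hasFDerivAt
    ((hasDerivAt_id x).prodMk (hasDerivAt_const x (y, z)))

lemma hasDerivAt_y (hf : SmoothThree f) (x y z : ℝ) :
    HasDerivAt (fun y' => f x y' z)
      (fderiv ℝ (fun p : ℝ × ℝ × ℝ => f p.1 p.2.1 p.2.2) (x, y, z) (0, 1, 0)) y :=
  HasFDerivAt.comp_hasDerivAt (l := fun p : ℝ × ℝ × ℝ => f p.1 p.2.1 p.2.2)
    (f := fun y' => (x, y', z)) y
    ((ContDiff.differentiable hf (by simp)) (x, y, z)).hasFDerivAt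
    ((hasDerivAt_const y x).prodMk ((hasDerivAt_id y).prodMk (hasDerivAt_const y z)))

lemma pdx_eq (hf : SmoothThree f) (x y z : ℝ) :
    pdx f x y z =
      fderiv ℝ (fun p : ℝ × ℝ × ℝ => f p.1 p.2.1 p.2.2) (x, y, z) (1, 0, 0) :=
  (hf.hasDerivAt_x x y z).deriv

lemma pdy_eq (hf : SmoothThree f) (x y z : ℝ) :
    pdy f x y z =
      fderiv ℝ (fun p : ℝ × ℝ × ℝ => f p.1 p.2.1 p.2.2) (x, y, z) (0, 1, 0) :=
  (hf.hasDerivAt_y x y z).deriv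

lemma hasDerivAt_pdx (hf : SmoothThree f) (x y z : ℝ) :
    HasDerivAt (fun x' => f x' y z) (pdx f x y z) x :=
  hf.pdx_eq x y z ▸ hf.hasDerivAt_x x y z

lemma hasDerivAt_pdy (hf : SmoothThree f) (x y z : ℝ) :
    HasDerivAt (fun y' => f x y' z) (pdy f x y z) y :=
  hf.pdy_eq x y z ▸ hf.hasDerivAt_y x y z

lemma contDiff_fderiv (hf : SmoothThree f) :
    ContDiff ℝ ∞ (fderiv ℝ (fun p : ℝ × ℝ × ℝ => f p.1 p.2.1 p.2.2)) :=
  ContDiff.fderiv_right hf (m := ∞) (by simp)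

lemma smooth_pdx (hf : SmoothThree f) : SmoothThree (pdx f) := by
  simpa only [SmoothThree, hf.pdx_eq] using hf.contDiff_fderiv.clm_apply contDiff_const

lemma smooth_pdy (hf : SmoothThree f) : SmoothThree (pdy f) := by
  simpa only [SmoothThree, hf.pdy_eq] using hf.contDiff_fderiv.clm_apply contDiff_const

lemma smooth_pdy_iterate (hf : SmoothThree f) (b : ℕ) : SmoothThree (pdy^[b] f) := by
  induction b with
  | zero => exact hf
  | succ b ih => rw [Function.iterate_succ_apply']; exact ih.smooth_pdy

lemma smooth_pdx_iterate (hf : SmoothThree f) (a : ℕ) : SmoothThree (pdx^[a] f) := by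
  induction a with
  | zero => exact hf
  | succ a ih => rw [Function.iterate_succ_apply']; exact ih.smooth_pdx

lemma smooth_pdh (hf : SmoothThree f) (a b : ℕ) : SmoothThree (pdh a b f) :=
  (hf.smooth_pdy_iterate b).smooth_pdx_iterate a

lemma pdy_pdx (hf : SmoothThree f) : pdy (pdx f) = pdx (pdy f) := by
  funext x y z
  have hd : DifferentiableAt ℝ (fderiv ℝ (fun p : ℝ × ℝ × ℝ => f p.1 p.2.1 p.2.2)) (x, y, z) :=
    hf.contDiff_fderiv.differentiable (by simp) _
  have hs : IsSymmSndFDerivAt ℝ (fun p : ℝ × ℝ × ℝ => f p.1 p.2.1 p.2.2) (x, y, z) :=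
    (ContDiff.contDiffAt hf).isSymmSndFDerivAt
      (by simpa using ENat.LEInfty.out)
  rw [hf.smooth_pdx.pdy_eq, hf.smooth_pdy.pdx_eq]
  simp only [hf.pdx_eq, hf.pdy_eq]
  rw [fderiv_clm_apply hd (by fun_prop), fderiv_clm_apply hd (by fun_prop)]
  simpa using hs.eq _ _

lemma pdy_pdh (hf : SmoothThree f) (a b : ℕ) :
    pdy (pdh a b f) = pdh a (b + 1) f := by
  induction a with
  | zero => exact (Function.iterate_succ_apply' pdy b f).symm
  | succ a ih =>
    have h (b : ℕ) : pdh (a + 1) b f = pdx (pdh a b f) :=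
      Function.iterate_succ_apply' _ _ _
    rw [h, h, (hf.smooth_pdh a b).pdy_pdx, ih]

end SmoothThree

lemma pdx_pdh (f : ℝ → ℝ → ℝ → ℝ) (a b : ℕ) : pdx (pdh a b f) = pdh (a + 1) b f :=
  (Function.iterate_succ_apply' _ _ _).symm

lemma hasDerivAt_intervalIntegral_param {f f' : ℝ → ℝ → ℝ}
    (hf : Continuous f.uncurry) (hf' : Continuous f'.uncurry)
    (hd : ∀ x s, HasDerivAt (fun x' => f x' s) (f' x s) x) (a b x : ℝ) :
    HasDerivAt (fun x' => ∫ s in a..b, f x' s) (∫ s in a..b, f' x s) x := by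
  have hc (x : ℝ) : Continuous (f x) := hf.comp (Continuous.prodMk_right x)
  obtain ⟨M, hM⟩ := ((isCompact_closedBall x 1).prod
    (isCompact_uIcc (a := a) (b := b))).exists_bound_of_continuousOn hf'.continuousOn
  refine (intervalIntegral.hasDerivAt_integral_of_dominated_loc_of_deriv_le
    (Metric.closedBall_mem_nhds x one_pos) (.of_forall fun x => (hc x).aestronglyMeasurable)
    ((hc x).intervalIntegrable a b)
    (hf'.comp (Continuous.prodMk_right x)).aestronglyMeasurable (bound := fun _ => M)
    (.of_forall fun s hs x' hx' => hM (x', s) ⟨hx', uIoc_subset_uIcc hs⟩)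
    intervalIntegrable_const (.of_forall fun s _ x' _ => hd x' s)).2

lemma pdx_phiF {f : ℝ → ℝ → ℝ → ℝ} (t : ℝ) (hf : SmoothThree f) :
    pdx (phiF t f) = phiF t (pdx f) := by
  funext x y z
  have h1 : Continuous (fun p : ℝ × ℝ × ℝ => f p.1 p.2.1 p.2.2) := ContDiff.continuous hf
  have h2 : Continuous (fun p : ℝ × ℝ × ℝ => pdx f p.1 p.2.1 p.2.2) :=
    ContDiff.continuous hf.smooth_pdx
  refine HasDerivAt.deriv (HasDerivAt.const_mul _ (hasDerivAt_intervalIntegral_param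
    (f := fun x s => f x y s * Real.exp (s ^ 2 / (4 * angT t)))
    (f' := fun x s => pdx f x y s * Real.exp (s ^ 2 / (4 * angT t))) ?_ ?_
    (fun x s => (hf.hasDerivAt_pdx x y s).mul_const _) 0 z x))
  · exact (h1.comp (by fun_prop : Continuous fun q : ℝ × ℝ => (q.1, y, q.2))).mul (by fun_prop)
  · exact (h2.comp (by fun_prop : Continuous fun q : ℝ × ℝ => (q.1, y, q.2))).mul (by fun_prop)

lemma pdy_phiF {f : ℝ → ℝ → ℝ → ℝ} (t : ℝ) (hf : SmoothThree f) :
    pdy (phiF t f) = phiF t (pdy f) := by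
  funext x y z
  have h1 : Continuous (fun p : ℝ × ℝ × ℝ => f p.1 p.2.1 p.2.2) := ContDiff.continuous hf
  have h2 : Continuous (fun p : ℝ × ℝ × ℝ => pdy f p.1 p.2.1 p.2.2) :=
    ContDiff.continuous hf.smooth_pdy
  refine HasDerivAt.deriv (HasDerivAt.const_mul _ (hasDerivAt_intervalIntegral_param
    (f := fun y s => f x y s * Real.exp (s ^ 2 / (4 * angT t)))
    (f' := fun y s => pdy f x y s * Real.exp (s ^ 2 / (4 * angT t))) ?_ ?_
    (fun y s => (hf.hasDerivAt_pdy x y s).mul_const _) 0 z y))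
  · exact (h1.comp (by fun_prop : Continuous fun q : ℝ × ℝ => (x, q.1, q.2))).mul (by fun_prop)
  · exact (h2.comp (by fun_prop : Continuous fun q : ℝ × ℝ => (x, q.1, q.2))).mul (by fun_prop)

lemma pdh_phiF {f : ℝ → ℝ → ℝ → ℝ} (t : ℝ) (hf : SmoothThree f) (a b : ℕ) :
    pdh a b (phiF t f) = phiF t (pdh a b f) := by
  have hy (b : ℕ) : pdy^[b] (phiF t f) = phiF t (pdy^[b] f) := by
    induction b with
    | zero => rfl
    | succ b ih => rw [Function.iterate_succ_apply', Function.iterate_succ_apply', ih,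
        pdy_phiF t (hf.smooth_pdy_iterate b)]
  induction a with
  | zero => exact hy b
  | succ a ih => rw [← pdx_pdh, ← pdx_pdh, ih, pdx_phiF t (hf.smooth_pdh a b)]

/-- One-dimensional Sobolev embedding of `H¹` into `L^∞`. -/
lemma sq_le_two_mul_integral {v v' : ℝ → ℝ} (hd : ∀ x, HasDerivAt v (v' x) x)
    (hv' : Continuous v') (c : ℝ) :
    v c ^ 2 ≤ 2 * ∫ x in c..c + 1, (v x ^ 2 + v' x ^ 2) := by
  have hv : Continuous v := continuous_iff_continuousAt.2 fun x => (hd x).continuousAt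
  have hi {w : ℝ → ℝ} (hw : Continuous w) (a b : ℝ) : IntervalIntegrable w volume a b :=
    hw.intervalIntegrable a b
  set J := ∫ x in c..c + 1, (v x ^ 2 + v' x ^ 2)
  have key : ∀ s ∈ Icc c (c + 1), v c ^ 2 ≤ v s ^ 2 + J := by
    intro s hs
    have hftc : ∫ x in c..s, 2 * v x * v' x = v s ^ 2 - v c ^ 2 := by
      refine intervalIntegral.integral_eq_sub_of_hasDerivAt (f := fun x => v x ^ 2)
        (f' := fun x => 2 * v x * v' x) (fun x _ => ?_) (hi (by fun_prop) _ _)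
      exact ((hd x).pow 2).congr_deriv (by simp)
    have h1 : ∫ x in c..s, -(2 * v x * v' x) ≤ ∫ x in c..s, (v x ^ 2 + v' x ^ 2) :=
      intervalIntegral.integral_mono_on hs.1 (hi (by fun_prop) _ _) (hi (by fun_prop) _ _)
        fun x _ => by nlinarith [sq_nonneg (v x + v' x)]
    have h2 : ∫ x in c..s, (v x ^ 2 + v' x ^ 2) ≤ J :=
      intervalIntegral.integral_mono_interval le_rfl hs.1 hs.2
        (.of_forall fun x => by positivity) (hi (by fun_prop) _ _)
    rw [intervalIntegral.integral_neg, hftc] at h1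
    linarith
  have h3 : ∫ _ in c..c + 1, v c ^ 2 ≤ ∫ s in c..c + 1, (v s ^ 2 + J) :=
    intervalIntegral.integral_mono_on (by linarith) (hi (by fun_prop) _ _) (hi (by fun_prop) _ _) key
  have h4 : ∫ s in c..c + 1, v s ^ 2 ≤ J :=
    intervalIntegral.integral_mono_on (by linarith) (hi (by fun_prop) _ _) (hi (by fun_prop) _ _)
      fun x _ => by nlinarith [sq_nonneg (v' x)]
  rw [intervalIntegral.integral_add (hi (by fun_prop) _ _) (hi (by fun_prop) _ _)] at h3
  simp at h3
  linarith

lemma ofReal_sq_le_lintegral {v v' : ℝ → ℝ} (hd : ∀ x, HasDerivAt v (v' x) x)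
    (hv' : Continuous v') (c : ℝ) :
    ENNReal.ofReal (v c ^ 2) ≤
      2 * ∫⁻ x, (ENNReal.ofReal (v x ^ 2) + ENNReal.ofReal (v' x ^ 2)) := by
  have hv : Continuous v := continuous_iff_continuousAt.2 fun x => (hd x).continuousAt
  have hinteg : IntervalIntegrable (fun x => v x ^ 2 + v' x ^ 2) volume c (c + 1) :=
    Continuous.intervalIntegrable (by fun_prop) _ _
  have hle : c ≤ c + 1 := by linarith
  calc ENNReal.ofReal (v c ^ 2)
      ≤ ENNReal.ofReal (2 * ∫ x in c..c + 1, (v x ^ 2 + v' x ^ 2)) :=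
        ENNReal.ofReal_le_ofReal (sq_le_two_mul_integral hd hv' c)
    _ = 2 * ∫⁻ x in Ioc c (c + 1), ENNReal.ofReal (v x ^ 2 + v' x ^ 2) := by
        rw [ENNReal.ofReal_mul zero_le_two, intervalIntegral.integral_of_le hle,
          ofReal_integral_eq_lintegral_ofReal
            ((intervalIntegrable_iff_integrableOn_Ioc_of_le hle).1 hinteg)
            (.of_forall fun x => by positivity)]
        simp
    _ ≤ 2 * ∫⁻ x, ENNReal.ofReal (v x ^ 2 + v' x ^ 2) := by
        gcongr; exact Measure.restrict_le_self
    _ = _ := by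
        simp_rw [ENNReal.ofReal_add (sq_nonneg _) (sq_nonneg _)]

/-- Trace estimate: a slice of an `L²` function whose first partial derivative is in `L²` is
in `L²`. -/
lemma lintegral_slice_lt_top {α : Type*} [TopologicalSpace α] [MeasurableSpace α] [BorelSpace α]
    [SecondCountableTopology α] {μ : Measure α} [SFinite μ] {f f' : ℝ → α → ℝ}
    (hf : Continuous f.uncurry) (hf' : Continuous f'.uncurry)
    (hd : ∀ x a, HasDerivAt (fun x' => f x' a) (f' x a) x)
    (h : ∫⁻ x, ∫⁻ a, ENNReal.ofReal (f x a ^ 2) ∂μ < ⊤)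
    (h' : ∫⁻ x, ∫⁻ a, ENNReal.ofReal (f' x a ^ 2) ∂μ < ⊤) (c : ℝ) :
    ∫⁻ a, ENNReal.ofReal (f c a ^ 2) ∂μ < ⊤ := by
  have hm : Measurable (fun p : ℝ × α => ENNReal.ofReal (f p.1 p.2 ^ 2)) :=
    (ENNReal.continuous_ofReal.comp (hf.pow 2)).measurable
  have hm' : Measurable (fun p : ℝ × α => ENNReal.ofReal (f' p.1 p.2 ^ 2)) :=
    (ENNReal.continuous_ofReal.comp (hf'.pow 2)).measurable
  calc ∫⁻ a, ENNReal.ofReal (f c a ^ 2) ∂μ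
      ≤ ∫⁻ a, (2 * ∫⁻ x, (ENNReal.ofReal (f x a ^ 2) + ENNReal.ofReal (f' x a ^ 2))) ∂μ :=
        lintegral_mono fun a => ofReal_sq_le_lintegral (v := fun x => f x a)
          (v' := fun x => f' x a) (hd · a) (hf'.comp (Continuous.prodMk_left a)) c
    _ = 2 * ∫⁻ x, ∫⁻ a, (ENNReal.ofReal (f x a ^ 2) + ENNReal.ofReal (f' x a ^ 2)) ∂μ := by
        rw [lintegral_const_mul' _ _ (by simp), lintegral_lintegral_swap]
        exact ((hm.add hm').comp measurable_swap).aemeasurable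
    _ = 2 * ((∫⁻ x, ∫⁻ a, ENNReal.ofReal (f x a ^ 2) ∂μ) +
          ∫⁻ x, ∫⁻ a, ENNReal.ofReal (f' x a ^ 2) ∂μ) := by
        rw [← lintegral_add_left hm.lintegral_prod_right']
        congr 1
        exact lintegral_congr fun x => lintegral_add_left (hm.comp measurable_prodMk_left) _
    _ < ⊤ := by finiteness

lemma lintegral_weighted_pdh_lt_top {t : ℝ} {g : ℝ → ℝ → ℝ → ℝ} (hg : SmoothThree g)
    (hL : L2cond t g) (a b : ℕ) :
    ∫⁻ x, ∫⁻ q, ENNReal.ofReal ((thw t 1 q.2 * pdh a b g x q.1 q.2) ^ 2)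
      ∂((volume : Measure ℝ).prod (volume.restrict (Ioi (0 : ℝ)))) < ⊤ := by
  have hc : Continuous (fun p : ℝ × ℝ × ℝ => pdh a b g p.1 p.2.1 p.2.2) :=
    ContDiff.continuous (hg.smooth_pdh a b)
  have hw : Continuous (fun p : ℝ × ℝ × ℝ => thw t 1 p.2.2) :=
    (continuous_thw t 1).comp (by fun_prop)
  have hset : {p : ℝ × ℝ × ℝ | 0 < p.2.2} = univ ×ˢ (univ ×ˢ Ioi (0 : ℝ)) := by ext; simp
  have hμ : (volume : Measure (ℝ × ℝ × ℝ)).restrict {p | 0 < p.2.2} =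
      (volume : Measure ℝ).prod ((volume : Measure ℝ).prod (volume.restrict (Ioi (0 : ℝ)))) := by
    rw [hset, Measure.volume_eq_prod, ← Measure.prod_restrict, Measure.volume_eq_prod,
      ← Measure.prod_restrict, Measure.restrict_univ]
  have hfin := (hL a b).lintegral_lt_top
  rw [hμ] at hfin
  have hm : Measurable (fun p : ℝ × ℝ × ℝ =>
      ENNReal.ofReal ((thw t 1 p.2.2 * pdh a b g p.1 p.2.1 p.2.2) ^ 2)) :=
    (ENNReal.continuous_ofReal.comp ((hw.mul hc).pow 2)).measurable
  rw [← lintegral_prod _ hm.aemeasurable]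
  refine lt_of_le_of_lt (lintegral_mono fun p => ENNReal.ofReal_le_ofReal ?_) hfin
  have h1 : 1 ≤ angR p.1 p.2.1 ^ (a + b) := one_le_pow₀ (one_le_angR _ _)
  have h2 : 1 ≤ (angR p.1 p.2.1 ^ (a + b)) ^ 2 := one_le_pow₀ h1
  calc _ = 1 * (thw t 1 p.2.2 * pdh a b g p.1 p.2.1 p.2.2) ^ 2 := (one_mul _).symm
    _ ≤ (angR p.1 p.2.1 ^ (a + b)) ^ 2 * (thw t 1 p.2.2 * pdh a b g p.1 p.2.1 p.2.2) ^ 2 := by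
        gcongr
    _ = _ := by ring

/-- By Sobolev embedding in the horizontal variables, the weighted `L²_z` norm is finite at every
`(x, y)`. -/
lemma integrableOn_weighted_pdh {t : ℝ} {g : ℝ → ℝ → ℝ → ℝ} (hg : SmoothThree g)
    (hL : L2cond t g) (a b : ℕ) (x y : ℝ) :
    IntegrableOn (fun z => (thw t 1 z * pdh a b g x y z) ^ 2) (Ioi 0) := by
  have hc (a b : ℕ) : Continuous (fun p : ℝ × ℝ × ℝ => pdh a b g p.1 p.2.1 p.2.2) :=
    ContDiff.continuous (hg.smooth_pdh a b)
  have hw := continuous_thw t 1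
  have hx (a b : ℕ) : ∫⁻ y, ∫⁻ z in Ioi (0 : ℝ),
      ENNReal.ofReal ((thw t 1 z * pdh a b g x y z) ^ 2) < ⊤ := by
    rw [lintegral_lintegral]
    · refine lintegral_slice_lt_top (f := fun x (q : ℝ × ℝ) => thw t 1 q.2 * pdh a b g x q.1 q.2)
        (f' := fun x (q : ℝ × ℝ) => thw t 1 q.2 * pdh (a + 1) b g x q.1 q.2)
        ((hw.comp (by fun_prop)).mul (hc a b)) ((hw.comp (by fun_prop)).mul (hc (a + 1) b))
        (fun x q => ?_) (lintegral_weighted_pdh_lt_top hg hL a b)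
        (lintegral_weighted_pdh_lt_top hg hL (a + 1) b) x
      rw [← pdx_pdh]
      exact ((hg.smooth_pdh a b).hasDerivAt_pdx x q.1 q.2).const_mul _
    · exact (ENNReal.continuous_ofReal.comp (((hw.comp continuous_snd).mul
        ((hc a b).comp (Continuous.prodMk_right x))).pow 2)).measurable.aemeasurable
  have hcx (a b : ℕ) : Continuous (fun q : ℝ × ℝ => thw t 1 q.2 * pdh a b g x q.1 q.2) :=
    (hw.comp continuous_snd).mul ((hc a b).comp (Continuous.prodMk_right x))
  have hfin : ∫⁻ z in Ioi (0 : ℝ), ENNReal.ofReal ((thw t 1 z * pdh a b g x y z) ^ 2) < ⊤ := by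
    refine lintegral_slice_lt_top (f := fun y z => thw t 1 z * pdh a b g x y z)
      (f' := fun y z => thw t 1 z * pdh a (b + 1) g x y z) (hcx a b) (hcx a (b + 1))
      (fun y z => ?_) (hx a b) (hx a (b + 1)) y
    rw [← hg.pdy_pdh]
    exact ((hg.smooth_pdh a b).hasDerivAt_pdy x y z).const_mul _
  have hcz := ((hcx a b).comp (Continuous.prodMk_right y)).pow 2
  exact ⟨hcz.aestronglyMeasurable,
    (hasFiniteIntegral_iff_ofReal (.of_forall fun z => sq_nonneg _)).2 hfin⟩

/-- Cauchy-Schwarz for interval integrals of continuous functions. -/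
lemma abs_intervalIntegral_mul_le {u v : ℝ → ℝ} (hu : Continuous u) (hv : Continuous v)
    {a b : ℝ} (hab : a ≤ b) :
    |∫ s in a..b, u s * v s| ≤
      Real.sqrt (∫ s in a..b, u s ^ 2) * Real.sqrt (∫ s in a..b, v s ^ 2) := by
  have hm {w : ℝ → ℝ} (hw : Continuous w) :
      MemLp w (ENNReal.ofReal 2) (volume.restrict (Ioc a b)) := by
    rw [ENNReal.ofReal_ofNat, memLp_two_iff_integrable_sq hw.aestronglyMeasurable]
    exact ((hw.pow 2).intervalIntegrable a b).1
  have h := integral_mul_le_Lp_mul_Lq_of_nonneg (μ := volume.restrict (Ioc a b))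
    Real.HolderConjugate.two_two (f := fun s => |u s|) (g := fun s => |v s|)
    (.of_forall fun s => abs_nonneg _) (.of_forall fun s => abs_nonneg _)
    (hm hu.abs) (hm hv.abs)
  simp only [intervalIntegral.integral_of_le hab]
  refine (abs_integral_le_integral_abs).trans ?_
  simpa [abs_mul, Real.sqrt_eq_rpow] using h

/-- Dawson-type bound. -/
lemma intervalIntegral_exp_sq_le {c z : ℝ} (hc : 0 < c) (hz : 0 ≤ z) :
    ∫ s in (0 : ℝ)..z, Real.exp (c * s ^ 2) ≤ Real.exp (c * z ^ 2) * Real.sqrt (Real.pi / c) := by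
  calc ∫ s in (0 : ℝ)..z, Real.exp (c * s ^ 2)
      ≤ ∫ s in (0 : ℝ)..z, Real.exp (c * z ^ 2) * Real.exp (-c * (z - s) ^ 2) := by
        refine intervalIntegral.integral_mono_on hz
          (Continuous.intervalIntegrable (by fun_prop) _ _)
          (Continuous.intervalIntegrable (by fun_prop) _ _) fun s hs => ?_
        rw [← Real.exp_add]
        refine Real.exp_le_exp.2 ?_
        nlinarith [mul_nonneg hc.le (mul_nonneg hs.1 (sub_nonneg.2 hs.2))]
    _ = Real.exp (c * z ^ 2) * ∫ s in (0 : ℝ)..z, Real.exp (-c * s ^ 2) := by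
        rw [intervalIntegral.integral_const_mul,
          intervalIntegral.integral_comp_sub_left (fun s => Real.exp (-c * s ^ 2))]
        simp
    _ ≤ Real.exp (c * z ^ 2) * ∫ s, Real.exp (-c * s ^ 2) := by
        rw [intervalIntegral.integral_of_le hz]
        exact mul_le_mul_of_nonneg_left (setIntegral_le_integral (integrable_exp_neg_mul_sq hc)
          (.of_forall fun s => (Real.exp_pos _).le)) (Real.exp_pos _).le
    _ = _ := by rw [integral_gaussian]

lemma abs_phiF_le {t : ℝ} (ht : 0 ≤ t) {f : ℝ → ℝ → ℝ → ℝ} {x y : ℝ}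
    (hf : Continuous (f x y))
    (hinteg : IntegrableOn (fun z => (thw t 1 z * f x y z) ^ 2) (Ioi 0)) {z : ℝ} (hz : 0 ≤ z) :
    |phiF t f x y z| ≤ (4 * Real.pi) ^ ((1 : ℝ) / 4) *
      (thw t (-1) z * angT t ^ ((1 : ℝ) / 4) *
        Real.sqrt (∫ z in Ioi (0 : ℝ), (thw t 1 z * f x y z) ^ 2)) := by
  have hT := angT_pos ht
  have hw := continuous_thw t 1
  have hsplit : ∫ s in (0 : ℝ)..z, f x y s * Real.exp (s ^ 2 / (4 * angT t)) =
      ∫ s in (0 : ℝ)..z, (thw t 1 s * f x y s) * thw t 1 s := by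
    refine intervalIntegral.integral_congr fun s _ => ?_
    have : Real.exp (s ^ 2 / (4 * angT t)) = thw t 1 s * thw t 1 s := by
      rw [thw, ← Real.exp_add]; congr 1; field_simp; ring
    simp only [this]; ring
  have h1 : ∫ s in (0 : ℝ)..z, (thw t 1 s * f x y s) ^ 2 ≤
      ∫ s in Ioi (0 : ℝ), (thw t 1 s * f x y s) ^ 2 := by
    rw [intervalIntegral.integral_of_le hz]
    exact setIntegral_mono_set hinteg (.of_forall fun s => sq_nonneg _)
      (Ioc_subset_Ioi_self).eventuallyLE
  have h2 : ∫ s in (0 : ℝ)..z, thw t 1 s ^ 2 ≤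
      thw t 1 z ^ 2 * Real.sqrt (4 * Real.pi * angT t) := by
    have hsq (s : ℝ) : thw t 1 s ^ 2 = Real.exp (1 / (4 * angT t) * s ^ 2) := by
      rw [thw, ← Real.exp_nat_mul]; congr 1; push_cast; field_simp; ring
    simp only [hsq]
    convert intervalIntegral_exp_sq_le (c := 1 / (4 * angT t)) (by positivity) hz using 3
    field_simp
  have h3 : Real.sqrt (thw t 1 z ^ 2 * Real.sqrt (4 * Real.pi * angT t)) =
      thw t 1 z * ((4 * Real.pi) ^ ((1 : ℝ) / 4) * angT t ^ ((1 : ℝ) / 4)) := by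
    rw [Real.sqrt_mul (sq_nonneg _), Real.sqrt_sq (x := thw t 1 z) (Real.exp_pos _).le,
      ← Real.mul_rpow (by positivity) hT.le, Real.sqrt_eq_rpow, Real.sqrt_eq_rpow,
      ← Real.rpow_mul (by positivity)]
    norm_num
  have h4 : Real.exp (-(z ^ 2) / (4 * angT t)) * thw t 1 z = thw t (-1) z := by
    rw [thw, thw, ← Real.exp_add]; congr 1; field_simp; norm_num
  rw [phiF, abs_mul, abs_of_pos (Real.exp_pos _), hsplit]
  calc _ ≤ Real.exp (-(z ^ 2) / (4 * angT t)) *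
        (Real.sqrt (∫ s in Ioi (0 : ℝ), (thw t 1 s * f x y s) ^ 2) *
          Real.sqrt (thw t 1 z ^ 2 * Real.sqrt (4 * Real.pi * angT t))) := by
        gcongr
        exact (abs_intervalIntegral_mul_le (hw.mul hf) hw hz).trans
          (mul_le_mul (Real.sqrt_le_sqrt h1) (Real.sqrt_le_sqrt h2) (Real.sqrt_nonneg _)
            (Real.sqrt_nonneg _))
    _ = _ := by rw [h3, ← h4]; ring

/-- pointwise weighted bound for the primitive `φ`. -/
theorem pointwise_bound_phi :
    ∀ lam : ℝ, 0 ≤ lam → lam < 1 → ∃ C : ℝ, 0 < C ∧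
      ∀ t : ℝ, 0 ≤ t → ∀ g : ℝ → ℝ → ℝ → ℝ, DecaySmooth g → L2cond t g →
        ∀ n a b : ℕ, a + b = n → ∀ x y z : ℝ, 0 ≤ z →
          thw t lam z * angR x y ^ n * |pdh a b (phiF t g) x y z| ≤
            C * (thw t (lam - 1) z * angT t ^ ((1 : ℝ) / 4) * L2z t 1 n (pdh a b g) x y) := by
  intro lam _ _
  refine ⟨(4 * Real.pi) ^ ((1 : ℝ) / 4), by positivity, ?_⟩
  intro t ht g hg hL n a b _ x y z hz
  have hs : SmoothThree g := hg.1
  have hR : 0 ≤ angR x y ^ n := pow_nonneg (Real.sqrt_nonneg _) n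
  have hcont : Continuous (pdh a b g x y) :=
    (ContDiff.continuous (hs.smooth_pdh a b)).comp
      (by fun_prop : Continuous fun z : ℝ => ((x, y, z) : ℝ × ℝ × ℝ))
  have hnorm : L2z t 1 n (pdh a b g) x y =
      angR x y ^ n * Real.sqrt (∫ z in Ioi (0 : ℝ), (thw t 1 z * pdh a b g x y z) ^ 2) := by
    have h (z : ℝ) : (thw t 1 z * angR x y ^ n * pdh a b g x y z) ^ 2 =
        (angR x y ^ n) ^ 2 * (thw t 1 z * pdh a b g x y z) ^ 2 := by ring
    simp only [L2z, h]
    rw [integral_const_mul, Real.sqrt_mul (sq_nonneg _), Real.sqrt_sq hR]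
  have hthw : thw t (lam - 1) z = thw t lam z * thw t (-1) z := by
    simp only [thw, ← Real.exp_add]; congr 1; ring
  have hφ := abs_phiF_le ht hcont (integrableOn_weighted_pdh hs hL a b x y) hz
  rw [pdh_phiF t hs, hnorm, hthw]
  calc _ ≤ thw t lam z * angR x y ^ n * _ :=
        mul_le_mul_of_nonneg_left hφ (mul_nonneg (Real.exp_pos _).le hR)
    _ = _ := by ring
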